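/- Let Φ ∈ OM_+^1 be non-trivial and suppose that either Φ*(0) = 0 or Φ(0) + Φ′(0) > 0. If f ∈ OM_+^1 satisfies f(0) = 0 and f preserves σ_Φ, then f is trivial (hence f(t) = t for all t > 0). -/

import Mathlib

open Matrix Filter Set Topology
open scoped ComplexOrder

noncomputable def matFun {n : ℕ} (f : ℝ → ℝ) (A : Matrix (Fin n) (Fin n) ℂ) :
    Matrix (Fin n) (Fin n) ℂ := cfc f A

def loewnerLE {n : ℕ} (A B : Matrix (Fin n) (Fin n) ℂ) : Prop := (B - A).PosSemidef

def OpMonotone (f : ℝ → ℝ) : Prop :=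
  ∀ (n : ℕ) (A B : Matrix (Fin n) (Fin n) ℂ), A.PosDef → B.PosDef →
    loewnerLE A B → loewnerLE (matFun f A) (matFun f B)

def OMone (f : ℝ → ℝ) : Prop :=
  (∀ t : ℝ, 0 < t → 0 < f t) ∧ f 1 = 1 ∧ OpMonotone f

noncomputable def kuboMean {n : ℕ} (Φ : ℝ → ℝ) (A B : Matrix (Fin n) (Fin n) ℂ) :
    Matrix (Fin n) (Fin n) ℂ :=
  matFun Real.sqrt A *
    matFun Φ (matFun (fun x => (Real.sqrt x)⁻¹) A * B * matFun (fun x => (Real.sqrt x)⁻¹) A) *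
    matFun Real.sqrt A

def Subpreserves (Φ f : ℝ → ℝ) : Prop :=
  ∀ (n : ℕ) (A B : Matrix (Fin n) (Fin n) ℂ), A.PosDef → B.PosDef →
    loewnerLE (matFun f (kuboMean Φ A B)) (kuboMean Φ (matFun f A) (matFun f B))

def PreservesMean (Φ f : ℝ → ℝ) : Prop :=
  ∀ (n : ℕ) (A B : Matrix (Fin n) (Fin n) ℂ), A.PosDef → B.PosDef →
    matFun f (kuboMean Φ A B) = kuboMean Φ (matFun f A) (matFun f B)

def OMTrivial (f : ℝ → ℝ) : Prop :=
  (∀ t : ℝ, 0 < t → f t = 1) ∨ (∀ t : ℝ, 0 < t → f t = t)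

noncomputable def adjFun (f : ℝ → ℝ) : ℝ → ℝ := fun t => (f t⁻¹)⁻¹

noncomputable def transFun (f : ℝ → ℝ) : ℝ → ℝ := fun t => t * f t⁻¹

open scoped MatrixOrder

section TwoPoint

variable {n : ℕ} {P : Matrix (Fin n) (Fin n) ℂ}

lemma isSelfAdjoint_twoPoint (hP : IsStarProjection P) (a b : ℝ) :
    IsSelfAdjoint (a • P + b • (1 - P)) :=
  ((IsSelfAdjoint.all a).smul hP.isSelfAdjoint).add
    ((IsSelfAdjoint.all b).smul hP.one_sub.isSelfAdjoint)

lemma twoPoint_mul (hP : IsStarProjection P) (a b c d : ℝ) :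
    (a • P + b • (1 - P)) * (c • P + d • (1 - P)) = (a * c) • P + (b * d) • (1 - P) := by
  have h : P * P = P := hP.isIdempotentElem
  have h1 : P * (1 - P) = 0 := by rw [mul_sub, h]; simp
  have h2 : (1 - P) * P = 0 := by rw [sub_mul, h]; simp
  have h3 : (1 - P) * (1 - P) = 1 - P := by rw [mul_sub, h2]; simp
  simp only [add_mul, mul_add, smul_mul_smul_comm, h, h1, h2, h3]
  simp

lemma spectrum_twoPoint_subset (hP : IsStarProjection P) (a b : ℝ) :
    spectrum ℝ (a • P + b • (1 - P)) ⊆ {a, b} := by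
  intro x hx
  by_contra hxab
  simp only [mem_insert_iff, mem_singleton_iff, not_or] at hxab
  refine hx ?_
  have e : algebraMap ℝ (Matrix (Fin n) (Fin n) ℂ) x - (a • P + b • (1 - P)) =
      (x - a) • P + (x - b) • (1 - P) := by
    rw [Algebra.algebraMap_eq_smul_one]; module
  have ha : x - a ≠ 0 := sub_ne_zero.2 hxab.1
  have hb : x - b ≠ 0 := sub_ne_zero.2 hxab.2
  have key : ((x - a) • P + (x - b) • (1 - P)) * ((x - a)⁻¹ • P + (x - b)⁻¹ • (1 - P)) = 1 := by
    rw [twoPoint_mul hP, mul_inv_cancel₀ ha, mul_inv_cancel₀ hb]; simp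
  rw [spectrum.mem_resolventSet_iff, e]
  exact IsUnit.of_mul_eq_one _ key

lemma matFun_twoPoint (hP : IsStarProjection P) (g : ℝ → ℝ) (a b : ℝ) :
    matFun g (a • P + b • (1 - P)) = g a • P + g b • (1 - P) := by
  obtain ⟨α, β, ha, hb⟩ : ∃ α β : ℝ, g a = α + β * a ∧ g b = α + β * b := by
    rcases eq_or_ne a b with rfl | hab
    · exact ⟨g a, 0, by simp, by simp⟩
    · have : a - b ≠ 0 := sub_ne_zero.2 hab
      exact ⟨g a - (g a - g b) / (a - b) * a, (g a - g b) / (a - b), by ring, by field_simp; ring⟩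
  have hM := isSelfAdjoint_twoPoint hP a b
  have hc : cfc g (a • P + b • (1 - P)) = cfc (fun x => α + β * x) (a • P + b • (1 - P)) := by
    refine cfc_congr fun x hx => ?_
    rcases spectrum_twoPoint_subset hP a b hx with rfl | rfl
    exacts [ha, hb]
  rw [matFun, hc, cfc_const_add α (fun x => β * x) _ , cfc_const_mul_id β _, ha, hb,
    Algebra.algebraMap_eq_smul_one]
  module

lemma posSemidef_of_isStarProjection (hP : IsStarProjection P) : P.PosSemidef := by
  have h := posSemidef_conjTranspose_mul_self P
  rwa [← star_eq_conjTranspose, hP.isSelfAdjoint.star_eq, hP.isIdempotentElem] at h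

lemma posSemidef_twoPoint (hP : IsStarProjection P) {a b : ℝ} (ha : 0 ≤ a) (hb : 0 ≤ b) :
    (a • P + b • (1 - P)).PosSemidef :=
  ((posSemidef_of_isStarProjection hP).smul ha).add
    ((posSemidef_of_isStarProjection hP.one_sub).smul hb)

lemma twoPoint_inv_mul (hP : IsStarProjection P) {a b : ℝ} (ha : a ≠ 0) (hb : b ≠ 0) :
    (a⁻¹ • P + b⁻¹ • (1 - P)) * (a • P + b • (1 - P)) = 1 := by
  rw [twoPoint_mul hP, inv_mul_cancel₀ ha, inv_mul_cancel₀ hb]; simp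

lemma posDef_twoPoint (hP : IsStarProjection P) {a b : ℝ} (ha : 0 < a) (hb : 0 < b) :
    (a • P + b • (1 - P)).PosDef :=
  (posSemidef_twoPoint hP ha.le hb.le).posDef_iff_isUnit.2
    (IsUnit.of_mul_eq_one_right _ (twoPoint_inv_mul hP ha.ne' hb.ne'))

end TwoPoint

section Continuity

open scoped Matrix.Norms.L2Operator

lemma continuous_matFun {X : Type*} [TopologicalSpace X] {n : ℕ} {g : ℝ → ℝ} (hg : Continuous g)
    {a : X → Matrix (Fin n) (Fin n) ℂ} (ha : Continuous a) (hs : ∀ x, IsSelfAdjoint (a x)) :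
    Continuous fun x => matFun g (a x) :=
  Continuous.cfc_of_mem_nhdsSet (s := univ) g univ_mem ha hs hg.continuousOn

end Continuity

section Adjoint

variable {n : ℕ} {A B : Matrix (Fin n) (Fin n) ℂ}

lemma continuousOn_spectrum (g : ℝ → ℝ) (A : Matrix (Fin n) (Fin n) ℂ) :
    ContinuousOn g (spectrum ℝ A) :=
  A.finite_real_spectrum.continuousOn g

lemma continuousOn_image_spectrum (g h : ℝ → ℝ) (A : Matrix (Fin n) (Fin n) ℂ) :
    ContinuousOn g (h '' spectrum ℝ A) :=
  (A.finite_real_spectrum.image h).continuousOn g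

open scoped Matrix.Norms.L2Operator in
lemma loewnerLE_inv (hA : A.PosDef) (h : loewnerLE A B) : loewnerLE B⁻¹ A⁻¹ := by
  have := CStarAlgebra.ringInverse_le_ringInverse (a := A) (b := B) h hA.isStrictlyPositive
  rwa [← Matrix.nonsing_inv_eq_ringInverse, ← Matrix.nonsing_inv_eq_ringInverse] at this

end Adjoint

lemma spectrum_pos_of_posDef {n : ℕ} {A : Matrix (Fin n) (Fin n) ℂ} (hA : A.PosDef) {x : ℝ}
    (hx : x ∈ spectrum ℝ A) : 0 < x := by
  rw [hA.isHermitian.spectrum_real_eq_range_eigenvalues] at hx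
  obtain ⟨i, rfl⟩ := hx
  exact hA.eigenvalues_pos i

lemma posDef_matFun {n : ℕ} {A : Matrix (Fin n) (Fin n) ℂ} (hA : A.PosDef) {g : ℝ → ℝ}
    (hg : ∀ t, 0 < t → 0 < g t) : (matFun g A).PosDef := by
  rw [matFun, hA.isHermitian.cfc_eq, IsHermitian.cfc, Unitary.conjStarAlgAut_apply,
    IsUnit.posDef_star_right_conjugate_iff (Unitary.isUnit_coe), posDef_diagonal_iff]
  intro i
  simpa using hg _ (hA.eigenvalues_pos i)

lemma matFun_adjFun {n : ℕ} {A : Matrix (Fin n) (Fin n) ℂ} (hA : A.PosDef) {g : ℝ → ℝ}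
    (hg : ∀ t, 0 < t → 0 < g t) : matFun (adjFun g) A = (matFun g A⁻¹)⁻¹ := by
  have hne : ∀ x ∈ spectrum ℝ A, x ≠ 0 := fun x hx => (spectrum_pos_of_posDef hA hx).ne'
  have hsa : IsSelfAdjoint A := hA.isHermitian
  have h1 : A⁻¹ = cfc (fun x : ℝ => x⁻¹) A := by
    rw [cfc_inv (fun x : ℝ => x) A hne (continuousOn_spectrum _ _), cfc_id' ℝ A,
      Matrix.nonsing_inv_eq_ringInverse]
  rw [matFun, matFun, h1, ← cfc_comp' g (fun x : ℝ => x⁻¹) A (continuousOn_image_spectrum _ _ _) (continuousOn_spectrum _ _), Matrix.nonsing_inv_eq_ringInverse,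
    ← cfc_inv (fun x : ℝ => g x⁻¹) A (fun x hx => (hg _ (inv_pos.2 (spectrum_pos_of_posDef hA hx))).ne') (continuousOn_spectrum _ _)]
  rfl

lemma OMone.adjFun {g : ℝ → ℝ} (hg : OMone g) : OMone (adjFun g) := by
  refine ⟨fun t ht => inv_pos.2 (hg.1 _ (inv_pos.2 ht)), by simp [_root_.adjFun, hg.2.1], ?_⟩
  intro n A B hA hB h
  rw [matFun_adjFun hA hg.1, matFun_adjFun hB hg.1]
  exact loewnerLE_inv (posDef_matFun hB.inv hg.1)
    (hg.2.2 n _ _ hB.inv hA.inv (loewnerLE_inv hA h))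

/-- The projection of `ℂ²` onto the line spanned by the vector `(c, s)`, if `c² + s² = 1`. -/
noncomputable def lineProj (c s : ℝ) : Matrix (Fin 2) (Fin 2) ℂ :=
  !![(c ^ 2 : ℂ), c * s; c * s, s ^ 2]

lemma isStarProjection_lineProj {c s : ℝ} (h : c ^ 2 + s ^ 2 = 1) :
    IsStarProjection (lineProj c s) := by
  have h' : (c : ℂ) ^ 2 + (s : ℂ) ^ 2 = 1 := by exact_mod_cast h
  constructor
  · rw [IsIdempotentElem, lineProj]
    ext i j
    fin_cases i <;> fin_cases j <;> simp [Matrix.mul_apply, Fin.sum_univ_two]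
    · linear_combination (c : ℂ) ^ 2 * h'
    · linear_combination (c : ℂ) * s * h'
    · linear_combination (c : ℂ) * s * h'
    · linear_combination (s : ℂ) ^ 2 * h'
  · rw [IsSelfAdjoint, lineProj, star_eq_conjTranspose]
    ext i j
    fin_cases i <;> fin_cases j <;> simp

lemma twoPoint_lineProj_apply_zero {c s : ℝ} (h : c ^ 2 + s ^ 2 = 1) (a b : ℝ) :
    (a • lineProj c s + b • (1 - lineProj c s)) 0 0 = ((c ^ 2 * a + s ^ 2 * b : ℝ) : ℂ) := by
  have h' : (c : ℂ) ^ 2 + (s : ℂ) ^ 2 = 1 := by exact_mod_cast h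
  simp [lineProj]
  linear_combination (-(b : ℂ)) * h'

lemma exists_loewnerLE_lineProj {c s : ℝ} (h : c ^ 2 + s ^ 2 = 1) {a b y : ℝ} (ha : 0 < a)
    (hb : 0 < b) (hy : c ^ 2 * a + s ^ 2 * b < y) :
    ∃ m : ℝ, 0 < m ∧ loewnerLE (a • lineProj c s + b • (1 - lineProj c s))
      (y • lineProj 1 0 + m • (1 - lineProj 1 0)) := by
  set ε := y - (c ^ 2 * a + s ^ 2 * b) with hε
  have hε0 : 0 < ε := sub_pos.2 hy
  have hr : √ε ≠ 0 := (Real.sqrt_pos.2 hε0).ne'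
  have hr2 : √ε * √ε = ε := Real.mul_self_sqrt hε0.le
  refine ⟨s ^ 2 * a + c ^ 2 * b + ((a - b) * c * s / √ε) ^ 2, ?_, ?_⟩
  · have : 0 < min a b := lt_min ha hb
    have h1 : min a b ≤ s ^ 2 * a + c ^ 2 * b := by
      nlinarith [min_le_left a b, min_le_right a b, sq_nonneg c, sq_nonneg s]
    have := sq_nonneg ((a - b) * c * s / √ε)
    linarith
  · have := posSemidef_vecMulVec_self_star
      ![((√ε : ℝ) : ℂ), ((-((a - b) * c * s / √ε) : ℝ) : ℂ)]
    rw [loewnerLE]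
    convert this using 1
    have h' : (c : ℂ) ^ 2 + (s : ℂ) ^ 2 = 1 := by exact_mod_cast h
    have hrC : ((√ε : ℝ) : ℂ) ≠ 0 := by exact_mod_cast hr
    have hr2C : ((√ε : ℝ) : ℂ) * √ε = y - (c ^ 2 * a + s ^ 2 * b) := by
      rw [← Complex.ofReal_mul, hr2, hε]; push_cast; ring
    ext i j
    fin_cases i <;> fin_cases j <;> simp [lineProj, vecMulVec_apply]
    · rw [hr2C]
      linear_combination (b : ℂ) * h'
    · field_simp
      ring
    · field_simp
      ring
    · field_simp
      linear_combination (b : ℂ) * (√ε : ℂ) ^ 2 * h'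

lemma OMone.weighted_le {g : ℝ → ℝ} (hg : OMone g) {c s : ℝ} (h : c ^ 2 + s ^ 2 = 1) {a b y : ℝ}
    (ha : 0 < a) (hb : 0 < b) (hy : c ^ 2 * a + s ^ 2 * b < y) :
    c ^ 2 * g a + s ^ 2 * g b ≤ g y := by
  have hy0 : 0 < y := lt_of_le_of_lt (by positivity) hy
  obtain ⟨m, hm, hle⟩ := exists_loewnerLE_lineProj h ha hb hy
  have hP := isStarProjection_lineProj h
  have hE := isStarProjection_lineProj (c := 1) (s := 0) (by norm_num)
  have := hg.2.2 2 _ _ (posDef_twoPoint hP ha hb) (posDef_twoPoint hE hy0 hm) hle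
  rw [matFun_twoPoint hP, matFun_twoPoint hE, loewnerLE] at this
  have h00 := this.diag_nonneg (i := 0)
  rw [Matrix.sub_apply, twoPoint_lineProj_apply_zero h,
    twoPoint_lineProj_apply_zero (by norm_num), ← Complex.ofReal_sub] at h00
  have := Complex.zero_le_real.1 h00
  linarith

lemma OMone.sq_mul_le {g : ℝ → ℝ} (hg : OMone g) {r x : ℝ} (hr : 0 < r) (hr1 : r < 1)
    (hx : 0 < x) : r ^ 2 * g x ≤ g (r * x) := by
  have hc : √(1 - r ^ 2) ^ 2 = 1 - r ^ 2 := Real.sq_sqrt (by nlinarith)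
  have ha : 0 < x * (r - r ^ 2) / 2 := by
    have : 0 < r - r ^ 2 := by nlinarith
    positivity
  have h := hg.weighted_le (c := √(1 - r ^ 2)) (s := r) (by rw [hc]; ring) ha hx (y := r * x)
    (by rw [hc]; nlinarith [mul_pos ha (sq_pos_of_pos hr)])
  have := mul_nonneg (sq_nonneg √(1 - r ^ 2)) (hg.1 _ ha).le
  linarith

lemma OMone.concaveOn {g : ℝ → ℝ} (hg : OMone g) : ConcaveOn ℝ (Ioi 0) g := by
  refine ⟨convex_Ioi 0, fun a ha b hb p q hp hq hpq => ?_⟩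
  simp only [smul_eq_mul, mem_Ioi] at *
  have hx : 0 < p * a + q * b := by
    rcases hp.eq_or_lt with rfl | hp
    · obtain rfl : q = 1 := by linarith
      simpa
    · positivity
  have key : ∀ r ∈ Ioo (0 : ℝ) 1, r ^ 2 * (p * g a + q * g b) ≤ g (p * a + q * b) := by
    intro r hr
    have h := hg.weighted_le (c := √p) (s := √q) (by rw [Real.sq_sqrt hp, Real.sq_sqrt hq, hpq])
      (mul_pos hr.1 ha) (mul_pos hr.1 hb) (y := p * a + q * b)
      (by rw [Real.sq_sqrt hp, Real.sq_sqrt hq]; nlinarith [hr.2])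
    rw [Real.sq_sqrt hp, Real.sq_sqrt hq] at h
    nlinarith [hg.sq_mul_le hr.1 hr.2 ha, hg.sq_mul_le hr.1 hr.2 hb]
  have hlim : Tendsto (fun r : ℝ => r ^ 2 * (p * g a + q * g b)) (𝓝[<] 1)
      (𝓝 (1 ^ 2 * (p * g a + q * g b))) :=
    Tendsto.mono_left (Continuous.tendsto (by fun_prop) 1) nhdsWithin_le_nhds
  have := le_of_tendsto hlim
    (by filter_upwards [Ioo_mem_nhdsLT (zero_lt_one (α := ℝ))] with r hr using key r hr)
  linarith

lemma OMone.monotoneOn {g : ℝ → ℝ} (hg : OMone g) : MonotoneOn g (Ioi 0) := by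
  intro x hx y _ hxy
  rcases hxy.eq_or_lt with rfl | hxy
  · rfl
  · simpa using hg.weighted_le (c := 1) (s := 0) (by norm_num) hx hx (y := y) (by simpa using hxy)

lemma OMone.continuousOn {g : ℝ → ℝ} (hg : OMone g) : ContinuousOn g (Ioi 0) :=
  hg.concaveOn.continuousOn isOpen_Ioi

lemma OMone.continuousAt {g : ℝ → ℝ} (hg : OMone g) {t : ℝ} (ht : 0 < t) : ContinuousAt g t :=
  hg.continuousOn.continuousAt (Ioi_mem_nhds ht)

lemma OMone.div_antitone {g : ℝ → ℝ} (hg : OMone g) {x y : ℝ} (hx : 0 < x) (hxy : x ≤ y) :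
    g y / y ≤ g x / x := by
  have hy : 0 < y := hx.trans_le hxy
  have hgy := hg.1 y hy
  rw [div_le_div_iff₀ hy hx]
  by_contra! hlt
  have h1 : g x / g y < x / y := by
    rw [div_lt_div_iff₀ hgy hy]; linarith
  obtain ⟨r, hr1, hr2⟩ := exists_between h1
  have hr0 : 0 < r := (div_pos (hg.1 x hx) hgy).trans hr1
  rw [div_lt_iff₀ hgy] at hr1
  rw [lt_div_iff₀ hy] at hr2
  have hr3 : r < 1 := by
    by_contra! h
    nlinarith
  have ha : 0 < (x - r * y) / 2 := by linarith
  have hc : √(1 - r) ^ 2 = 1 - r := Real.sq_sqrt (by linarith)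
  have hs : √r ^ 2 = r := Real.sq_sqrt hr0.le
  have h := hg.weighted_le (c := √(1 - r)) (s := √r) (by rw [hc, hs]; ring) ha hy (y := x)
    (by rw [hc, hs]; nlinarith)
  rw [hc, hs] at h
  nlinarith [mul_nonneg (sub_nonneg.2 hr3.le) (hg.1 _ ha).le]

lemma ConcaveOn.le_of_eqOn_Ioo {h : ℝ → ℝ} (hh : ConcaveOn ℝ (Ioi 0) h) {p q α k : ℝ} (hp : 0 ≤ p)
    (hpq : p < q) (heq : ∀ t ∈ Ioo p q, h t = α + k * t) {t : ℝ} (ht : 0 < t) :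
    h t ≤ α + k * t := by
  obtain ⟨x, hpx, hxq⟩ := exists_between hpq
  obtain ⟨y, hxy, hyq⟩ := exists_between hxq
  have hx := heq x ⟨hpx, hxq⟩
  have hy := heq y ⟨hpx.trans hxy, hyq⟩
  have hs : (h y - h x) / (y - x) = k := by
    have : y - x ≠ 0 := by linarith
    rw [hx, hy]; field_simp; ring
  have hx0 : 0 < x := hp.trans_lt hpx
  rcases lt_or_ge t x with htx | htx
  · have := hh.slope_anti_adjacent (x := t) (y := x) (z := y) ht (hx0.trans hxy) htx hxy
    rw [hs, le_div_iff₀ (by linarith)] at this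
    linarith
  rcases lt_or_ge y t with hty | hty
  · have := hh.slope_anti_adjacent (x := x) (y := y) (z := t) hx0 ht hxy hty
    rw [hs, div_le_iff₀ (by linarith)] at this
    linarith
  · exact (heq t ⟨by linarith, by linarith⟩).le

lemma OMone.omTrivial_of_linear {g : ℝ → ℝ} (hg : OMone g) {p q k : ℝ} (hp : 0 < p) (hpq : p < q)
    (heq : ∀ t ∈ Ioo p q, g t = k * t) : OMTrivial g := by
  have hk : 0 < k := by
    obtain ⟨x, hx⟩ := exists_between hpq
    have := hg.1 x (hp.trans hx.1)
    rw [heq x hx] at this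
    exact pos_of_mul_pos_left this (hp.trans hx.1).le
  have hq : 0 < q := hp.trans hpq
  have key : ∀ t, 0 < t → g t = k * t := by
    intro t ht
    refine le_antisymm ?_ ?_
    · simpa using hg.concaveOn.le_of_eqOn_Ioo hp.le hpq (α := 0) (by simpa using heq) ht
    · have h := hg.adjFun.concaveOn.le_of_eqOn_Ioo (p := q⁻¹) (q := p⁻¹) (α := 0) (k := k⁻¹)
        (inv_pos.2 hq).le ((inv_lt_inv₀ hq hp).2 hpq) (by
          intro u hu
          have hu0 : 0 < u := (inv_pos.2 hq).trans hu.1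
          rw [_root_.adjFun, heq u⁻¹ ⟨(lt_inv_comm₀ hp hu0).2 hu.2, (inv_lt_comm₀ hu0 hq).2 hu.1⟩]
          rw [mul_inv, inv_inv, zero_add]) (inv_pos.2 ht)
      rw [_root_.adjFun, inv_inv, zero_add, ← mul_inv] at h
      exact (inv_le_inv₀ (hg.1 t ht) (mul_pos hk ht)).1 h
  refine Or.inr fun t ht => ?_
  have h1 := key 1 one_pos
  rw [hg.2.1] at h1
  rw [key t ht]
  linear_combination (-t) * h1

lemma OMone.div_injOn {g : ℝ → ℝ} (hg : OMone g) (hnt : ¬ OMTrivial g) :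
    InjOn (fun t => g t / t) (Ioi 0) := by
  have aux : ∀ x y, 0 < x → x < y → g x / x ≠ g y / y := by
    intro x y hx hxy h
    refine hnt (hg.omTrivial_of_linear (k := g x / x) hx hxy fun t ht => ?_)
    have ht0 := hx.trans ht.1
    rw [← div_eq_iff ht0.ne']
    exact le_antisymm (hg.div_antitone hx ht.1.le) (h ▸ hg.div_antitone ht0 ht.2.le)
  intro x hx y hy h
  rcases lt_trichotomy x y with hlt | heq | hlt
  · exact absurd h (aux x y hx hlt)
  · exact heq
  · exact absurd h.symm (aux y x hy hlt)

lemma OMone.exists_tendsto_zero {g : ℝ → ℝ} (hg : OMone g) :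
    ∃ L, 0 ≤ L ∧ Tendsto g (𝓝[>] 0) (𝓝 L) ∧ ∀ t, 0 < t → L ≤ g t := by
  have hbdd : BddBelow (g '' Ioi 0) := ⟨0, by rintro _ ⟨t, ht, rfl⟩; exact (hg.1 t ht).le⟩
  refine ⟨sInf (g '' Ioi 0), ?_, hg.monotoneOn.tendsto_nhdsGT hbdd, ?_⟩
  · exact Real.sInf_nonneg (by rintro _ ⟨t, ht, rfl⟩; exact (hg.1 t ht).le)
  · exact fun t ht => csInf_le hbdd ⟨t, ht, rfl⟩

lemma OMone.tendsto_zero_lt_one {g : ℝ → ℝ} (hg : OMone g) (hnt : ¬ OMTrivial g) {L : ℝ}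
    (hL : ∀ t, 0 < t → L ≤ g t) : L < 1 := by
  by_contra! h
  refine hnt (Or.inl fun t ht => le_antisymm ?_ (h.trans (hL t ht)))
  simpa using hg.concaveOn.le_of_eqOn_Ioo (p := 0) (q := 1) (α := 1) (k := 0) le_rfl one_pos (by
    intro u hu
    have := hg.monotoneOn hu.1 (one_pos (α := ℝ)) hu.2.le
    rw [hg.2.1] at this
    linarith [hL u hu.1]) ht

lemma kuboMean_twoPoint {n : ℕ} {P : Matrix (Fin n) (Fin n) ℂ} (hP : IsStarProjection P)
    (g : ℝ → ℝ) {a b : ℝ} (ha : 0 ≤ a) (hb : 0 ≤ b) (c d : ℝ) :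
    kuboMean g (a • P + b • (1 - P)) (c • P + d • (1 - P)) =
      (a * g (c / a)) • P + (b * g (d / b)) • (1 - P) := by
  have aux : ∀ x y : ℝ, 0 ≤ x → √x * g ((√x)⁻¹ * y * (√x)⁻¹) * √x = x * g (y / x) := by
    intro x y hx
    have h1 : (√x)⁻¹ * y * (√x)⁻¹ = y / x := by
      rw [mul_right_comm, ← mul_inv, Real.mul_self_sqrt hx, mul_comm, div_eq_mul_inv]
    rw [h1, mul_right_comm, Real.mul_self_sqrt hx]
  simp only [kuboMean, matFun_twoPoint hP, twoPoint_mul hP, aux _ _ ha, aux _ _ hb]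

lemma PreservesMean.scalar {Φ f : ℝ → ℝ} (h : PreservesMean Φ f) (hf : ∀ t, 0 < t → 0 < f t)
    {a b : ℝ} (ha : 0 < a) (hb : 0 < b) :
    f (a * Φ (b / a)) = f a * Φ (f b / f a) := by
  have hc : (1 : ℝ) ^ 2 + 0 ^ 2 = 1 := by norm_num
  have hE := isStarProjection_lineProj hc
  have := h 2 _ _ (posDef_twoPoint hE ha ha) (posDef_twoPoint hE hb hb)
  rw [kuboMean_twoPoint hE Φ ha.le ha.le, matFun_twoPoint hE, matFun_twoPoint hE,
    matFun_twoPoint hE, kuboMean_twoPoint hE Φ (hf a ha).le (hf a ha).le] at this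
  have h00 := congrFun (congrFun this 0) 0
  rw [twoPoint_lineProj_apply_zero hc, twoPoint_lineProj_apply_zero hc] at h00
  simpa using Complex.ofReal_injective h00

lemma OMone.tendsto_nhdsGT_zero {f : ℝ → ℝ} (hf : OMone f) (hf0 : Tendsto f (𝓝[>] 0) (𝓝 0)) :
    Tendsto f (𝓝[>] 0) (𝓝[>] 0) :=
  tendsto_nhdsWithin_of_tendsto_nhds_of_eventually_within _ hf0
    (eventually_nhdsWithin_of_forall hf.1)

lemma tendsto_div_const_nhdsGT_zero {k : ℝ} (hk : 0 < k) :
    Tendsto (fun b : ℝ => b / k) (𝓝[>] 0) (𝓝[>] 0) := by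
  refine tendsto_nhdsWithin_of_tendsto_nhds_of_eventually_within _ ?_
    (eventually_nhdsWithin_of_forall fun b hb => div_pos hb hk)
  have : Tendsto (fun b : ℝ => b / k) (𝓝 0) (𝓝 (0 / k)) := tendsto_id.div_const k
  rw [zero_div] at this
  exact this.mono_left nhdsWithin_le_nhds

lemma PreservesMean.mul_limit_zero {Φ f : ℝ → ℝ} (h : PreservesMean Φ f) (hf : OMone f)
    (hf0 : Tendsto f (𝓝[>] 0) (𝓝 0)) {L : ℝ} (hL : 0 < L) (hΦL : Tendsto Φ (𝓝[>] 0) (𝓝 L))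
    {a : ℝ} (ha : 0 < a) : f (L * a) = L * f a := by
  have h1 : Tendsto (fun b => f (a * Φ (b / a))) (𝓝[>] 0) (𝓝 (f (a * L))) :=
    (hf.continuousAt (mul_pos ha hL)).tendsto.comp
      ((hΦL.comp (tendsto_div_const_nhdsGT_zero ha)).const_mul a)
  have h2 : Tendsto (fun b => f a * Φ (f b / f a)) (𝓝[>] 0) (𝓝 (f a * L)) :=
    (hΦL.comp ((tendsto_div_const_nhdsGT_zero (hf.1 a ha)).comp
      (hf.tendsto_nhdsGT_zero hf0))).const_mul (f a)
  have := tendsto_nhds_unique_of_eventuallyEq h1 h2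
    (eventually_nhdsWithin_of_forall fun b hb => h.scalar hf.1 ha hb)
  rw [mul_comm L a, this, mul_comm]

lemma OMone.eq_id_of_map_mul {f : ℝ → ℝ} (hf : OMone f) {L : ℝ} (hL : 0 < L) (hL1 : L < 1)
    (h : ∀ a, 0 < a → f (L * a) = L * f a) {t : ℝ} (ht : 0 < t) : f t = t := by
  have hpow : ∀ n : ℕ, f (L ^ n) = L ^ n := by
    intro n
    induction n with
    | zero => simpa using hf.2.1
    | succ n ih => rw [pow_succ', h _ (pow_pos hL n), ih]
  have hinv : ∀ n : ℕ, f (L ^ n)⁻¹ = (L ^ n)⁻¹ := by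
    intro n
    induction n with
    | zero => simpa using hf.2.1
    | succ n ih =>
      have := h (L ^ (n + 1))⁻¹ (inv_pos.2 (pow_pos hL _))
      have e : L * (L ^ (n + 1))⁻¹ = (L ^ n)⁻¹ := by
        rw [pow_succ', mul_inv, mul_inv_cancel_left₀ hL.ne']
      rw [e, ih] at this
      rw [eq_comm, ← mul_right_inj' hL.ne', ← this, e]
  obtain ⟨m, hm⟩ := exists_pow_lt_of_lt_one ht hL1
  obtain ⟨n, hn⟩ := exists_pow_lt_of_lt_one (inv_pos.2 ht) hL1
  have h1 := hf.div_antitone (pow_pos hL m) hm.le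
  rw [hpow, div_self (pow_pos hL m).ne', div_le_one ht] at h1
  have h2 := hf.div_antitone ht ((le_inv_comm₀ (pow_pos hL n) ht).1 hn.le)
  rw [hinv, div_self (inv_pos.2 (pow_pos hL n)).ne', one_le_div ht] at h2
  exact le_antisymm h1 h2

/-- The extension of a function on `(0, ∞)` by the constant `L` on `(-∞, 0]`. -/
noncomputable def extendConst (g : ℝ → ℝ) (L : ℝ) : ℝ → ℝ := fun t => if 0 < t then g t else L

lemma extendConst_of_pos {g : ℝ → ℝ} {L t : ℝ} (ht : 0 < t) : extendConst g L t = g t := if_pos ht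

lemma extendConst_zero (g : ℝ → ℝ) (L : ℝ) : extendConst g L 0 = L := if_neg (lt_irrefl 0)

lemma continuous_extendConst {g : ℝ → ℝ} {L : ℝ} (hg : ContinuousOn g (Ioi 0))
    (hL : Tendsto g (𝓝[>] 0) (𝓝 L)) : Continuous (extendConst g L) := by
  rw [continuous_iff_continuousAt]
  intro t
  rcases lt_trichotomy t 0 with ht | rfl | ht
  · refine (continuousAt_const (y := L)).congr ?_
    filter_upwards [Iio_mem_nhds ht] with u hu
    exact (if_neg (not_lt.2 (le_of_lt hu))).symm
  · rw [continuousAt_iff_continuous_left'_right']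
    constructor
    · rw [ContinuousWithinAt, extendConst_zero]
      refine tendsto_const_nhds.congr' (eventually_nhdsWithin_of_forall fun u hu => ?_)
      exact (if_neg (not_lt.2 (le_of_lt hu))).symm
    · rw [ContinuousWithinAt, extendConst_zero]
      exact hL.congr' (eventually_nhdsWithin_of_forall fun u hu => (extendConst_of_pos hu).symm)
  · refine (hg.continuousAt (Ioi_mem_nhds ht)).congr ?_
    filter_upwards [Ioi_mem_nhds ht] with u hu
    exact (extendConst_of_pos hu).symm

lemma matFun_extendConst {n : ℕ} {A : Matrix (Fin n) (Fin n) ℂ} (hA : A.PosDef) (g : ℝ → ℝ)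
    (L : ℝ) : matFun (extendConst g L) A = matFun g A :=
  cfc_congr fun _ hx => extendConst_of_pos (spectrum_pos_of_posDef hA hx)

lemma posDef_mul_mul_self {n : ℕ} {S B : Matrix (Fin n) (Fin n) ℂ} (hS : S.PosDef)
    (hB : B.PosDef) : (S * B * S).PosDef := by
  have h := (IsUnit.posDef_star_right_conjugate_iff (U := S) (x := B) hS.isUnit).2 hB
  rwa [star_eq_conjTranspose, hS.isHermitian.eq] at h

lemma posDef_kuboMean_arg {n : ℕ} {A B : Matrix (Fin n) (Fin n) ℂ} (hA : A.PosDef)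
    (hB : B.PosDef) :
    (matFun (fun x => (√x)⁻¹) A * B * matFun (fun x => (√x)⁻¹) A).PosDef :=
  posDef_mul_mul_self (posDef_matFun hA fun _ ht => inv_pos.2 (Real.sqrt_pos.2 ht)) hB

lemma posDef_kuboMean {n : ℕ} {A B : Matrix (Fin n) (Fin n) ℂ} (hA : A.PosDef)
    (hB : B.PosDef) {g : ℝ → ℝ} (hg : ∀ t, 0 < t → 0 < g t) : (kuboMean g A B).PosDef :=
  posDef_mul_mul_self (posDef_matFun hA fun _ ht => Real.sqrt_pos.2 ht)
    (posDef_matFun (posDef_kuboMean_arg hA hB) hg)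

lemma kuboMean_extendConst {n : ℕ} {A B : Matrix (Fin n) (Fin n) ℂ} (hA : A.PosDef)
    (hB : B.PosDef) (g : ℝ → ℝ) (L : ℝ) : kuboMean (extendConst g L) A B = kuboMean g A B := by
  rw [kuboMean, matFun_extendConst (posDef_kuboMean_arg hA hB), kuboMean]

lemma isSelfAdjoint_matFun {n : ℕ} (g : ℝ → ℝ) (A : Matrix (Fin n) (Fin n) ℂ) :
    IsSelfAdjoint (matFun g A) := cfc_predicate g A

lemma IsSelfAdjoint.mul_mul_self {n : ℕ} {S B : Matrix (Fin n) (Fin n) ℂ} (hS : IsSelfAdjoint S)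
    (hB : IsSelfAdjoint B) : IsSelfAdjoint (S * B * S) := by
  rw [IsSelfAdjoint, star_mul, star_mul, hS.star_eq, hB.star_eq, mul_assoc]

lemma isSelfAdjoint_kuboMean {n : ℕ} (g : ℝ → ℝ) (A B : Matrix (Fin n) (Fin n) ℂ) :
    IsSelfAdjoint (kuboMean g A B) :=
  (isSelfAdjoint_matFun _ _).mul_mul_self (isSelfAdjoint_matFun _ _)

lemma continuous_kuboMean {X : Type*} [TopologicalSpace X] {n : ℕ} {g : ℝ → ℝ} (hg : Continuous g)
    (A : Matrix (Fin n) (Fin n) ℂ) {B : X → Matrix (Fin n) (Fin n) ℂ} (hB : Continuous B)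
    (hs : ∀ x, IsSelfAdjoint (B x)) : Continuous fun x => kuboMean g A (B x) := by
  have h := continuous_matFun hg
    (a := fun x => matFun (fun x => (√x)⁻¹) A * B x * matFun (fun x => (√x)⁻¹) A)
    ((continuous_const.mul hB).mul continuous_const)
    fun x => (isSelfAdjoint_matFun _ _).mul_mul_self (hs x)
  exact (continuous_const.mul h).mul continuous_const

/-- If `f` and `Φ` have limits at `0`, then the preservation of `σ_Φ` extends to the case where
the second argument is a projection. -/
lemma PreservesMean.isStarProjection {Φ f : ℝ → ℝ} (h : PreservesMean Φ f) (hΦ : OMone Φ)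
    (hf : OMone f) {L : ℝ} (hΦL : Tendsto Φ (𝓝[>] 0) (𝓝 L)) (hf0 : Tendsto f (𝓝[>] 0) (𝓝 0))
    {n : ℕ} {A P : Matrix (Fin n) (Fin n) ℂ} (hA : A.PosDef) (hP : IsStarProjection P) :
    matFun (extendConst f 0) (kuboMean (extendConst Φ L) A P) =
      kuboMean (extendConst Φ L) (matFun f A) P := by
  have hΦc := continuous_extendConst hΦ.continuousOn hΦL
  have hfc := continuous_extendConst hf.continuousOn hf0
  let B : ℝ → Matrix (Fin n) (Fin n) ℂ := fun ε => (1 + ε) • P + ε • (1 - P)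
  let C : ℝ → Matrix (Fin n) (Fin n) ℂ := fun ε =>
    extendConst f 0 (1 + ε) • P + extendConst f 0 ε • (1 - P)
  have hB : Continuous B := by fun_prop
  have hC : Continuous C := by fun_prop
  have hl : Continuous fun ε => matFun (extendConst f 0) (kuboMean (extendConst Φ L) A (B ε)) :=
    continuous_matFun hfc (continuous_kuboMean hΦc A hB fun ε => isSelfAdjoint_twoPoint hP _ _)
      fun ε => isSelfAdjoint_kuboMean _ _ _
  have hr : Continuous fun ε => kuboMean (extendConst Φ L) (matFun f A) (C ε) :=
    continuous_kuboMean hΦc _ hC fun ε => isSelfAdjoint_twoPoint hP _ _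
  have heq : ∀ ε : ℝ, 0 < ε → matFun (extendConst f 0) (kuboMean (extendConst Φ L) A (B ε)) =
      kuboMean (extendConst Φ L) (matFun f A) (C ε) := by
    intro ε hε
    have hBε : (B ε).PosDef := posDef_twoPoint hP (by linarith) hε
    have hCε : C ε = matFun f (B ε) := by
      rw [← matFun_extendConst hBε f 0, matFun_twoPoint hP]
    rw [hCε, kuboMean_extendConst hA hBε, kuboMean_extendConst (posDef_matFun hA hf.1)
      (posDef_matFun hBε hf.1), matFun_extendConst (posDef_kuboMean hA hBε hΦ.1)]
    exact h n A (B ε) hA hBε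
  have h0 := tendsto_nhds_unique_of_eventuallyEq
    ((hl.tendsto 0).mono_left nhdsWithin_le_nhds) ((hr.tendsto 0).mono_left nhdsWithin_le_nhds)
    (eventually_nhdsWithin_of_forall (s := Ioi 0) heq)
  simpa [B, C, extendConst_zero, extendConst_of_pos one_pos, hf.2.1] using h0

lemma lineProj_mul_twoPoint_mul (c s x y : ℝ) :
    lineProj c s * (x • lineProj 1 0 + y • (1 - lineProj 1 0)) * lineProj c s =
      (c ^ 2 * x + s ^ 2 * y) • lineProj c s := by
  have h : x • lineProj 1 0 + y • (1 - lineProj 1 0) = !![(x : ℂ), 0; 0, y] := by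
    ext i j
    fin_cases i <;> fin_cases j <;> simp [lineProj]
  rw [h]
  ext i j
  fin_cases i <;> fin_cases j <;> simp [lineProj, Matrix.mul_apply, Fin.sum_univ_two] <;> ring

lemma smul_lineProj_injective {c s : ℝ} (h : c ^ 2 + s ^ 2 = 1) {x y : ℝ}
    (hxy : x • lineProj c s = y • lineProj c s) : x = y := by
  have h0 := congrFun (congrFun hxy 0) 0
  have h1 := congrFun (congrFun hxy 1) 1
  simp only [lineProj, Matrix.smul_apply, of_apply, cons_val', cons_val_zero, cons_val_one,
    cons_val_fin_one, Complex.real_smul] at h0 h1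
  norm_cast at h0 h1
  linear_combination h0 + h1 - (x - y) * h

lemma kuboMean_lineProj {g : ℝ → ℝ} (hg : g 0 = 0) {c s : ℝ} (h : c ^ 2 + s ^ 2 = 1) {a b : ℝ}
    (ha : 0 < a) (hb : 0 < b) :
    kuboMean g (a • lineProj 1 0 + b • (1 - lineProj 1 0)) (lineProj c s) =
      (g (c ^ 2 / a + s ^ 2 / b) / (c ^ 2 / a + s ^ 2 / b)) • lineProj c s := by
  have hE := isStarProjection_lineProj (c := 1) (s := 0) (by norm_num)
  have hP := isStarProjection_lineProj h
  set E := lineProj 1 0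
  set P := lineProj c s
  set r := c ^ 2 / a + s ^ 2 / b with hr
  have hr0 : 0 < r := by
    have h1 : 0 < c ^ 2 * b + s ^ 2 * a := by
      by_contra! h2
      have h3 : 0 < min a b := lt_min ha hb
      nlinarith [min_le_left a b, min_le_right a b, sq_nonneg c, sq_nonneg s]
    have : r = (c ^ 2 * b + s ^ 2 * a) / (a * b) := by rw [hr]; field_simp
    rw [this]
    positivity
  rw [kuboMean, matFun_twoPoint hE, matFun_twoPoint hE]
  set S := √a • E + √b • (1 - E)
  set T := (√a)⁻¹ • E + (√b)⁻¹ • (1 - E)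
  have hT : IsSelfAdjoint T := isSelfAdjoint_twoPoint hE _ _
  have ha' := (Real.sqrt_pos.2 ha).ne'
  have hb' := (Real.sqrt_pos.2 hb).ne'
  have hTS : T * S = 1 := twoPoint_inv_mul hE ha' hb'
  have hST : S * T = 1 := by
    simp only [S, T]
    rw [twoPoint_mul hE, mul_inv_cancel₀ ha', mul_inv_cancel₀ hb']; simp
  have hTT : T * T = a⁻¹ • E + b⁻¹ • (1 - E) := by
    simp only [T]
    rw [twoPoint_mul hE, ← mul_inv, ← mul_inv, Real.mul_self_sqrt ha.le, Real.mul_self_sqrt hb.le]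
  have hPTTP : P * (T * T) * P = r • P := by
    rw [hTT, lineProj_mul_twoPoint_mul, hr, div_eq_mul_inv, div_eq_mul_inv]
  have hQ : IsStarProjection (r⁻¹ • (T * P * T)) := by
    refine ⟨?_, (IsSelfAdjoint.all _).smul (hT.mul_mul_self hP.isSelfAdjoint)⟩
    have : T * P * T * (T * P * T) = r • (T * P * T) := by
      calc T * P * T * (T * P * T) = T * (P * (T * T) * P) * T := by noncomm_ring
        _ = r • (T * P * T) := by rw [hPTTP]; simp
    rw [IsIdempotentElem, smul_mul_smul_comm, this, smul_smul]
    congr 1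
    field_simp
  have hM : T * P * T = r • (r⁻¹ • (T * P * T)) + (0 : ℝ) • (1 - r⁻¹ • (T * P * T)) := by
    rw [smul_smul, mul_inv_cancel₀ hr0.ne']; simp
  rw [hM, matFun_twoPoint hQ, hg, zero_smul, add_zero, smul_smul, ← div_eq_mul_inv, mul_smul_comm,
    smul_mul_assoc]
  congr 1
  calc S * (T * P * T) * S = (S * T) * P * (T * S) := by noncomm_ring
    _ = P := by rw [hST, hTS]; simp

lemma PreservesMean.lineProj {Φ f : ℝ → ℝ} (h : PreservesMean Φ f) (hΦ : OMone Φ)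
    (hf : OMone f) (hΦ0 : Tendsto Φ (𝓝[>] 0) (𝓝 0)) (hf0 : Tendsto f (𝓝[>] 0) (𝓝 0))
    {c s : ℝ} (hcs : c ^ 2 + s ^ 2 = 1) {a b : ℝ} (ha : 0 < a) (hb : 0 < b) :
    extendConst f 0 (extendConst Φ 0 (c ^ 2 / a + s ^ 2 / b) / (c ^ 2 / a + s ^ 2 / b)) =
      extendConst Φ 0 (c ^ 2 / f a + s ^ 2 / f b) / (c ^ 2 / f a + s ^ 2 / f b) := by
  have hE := isStarProjection_lineProj (c := 1) (s := 0) (by norm_num)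
  have hP := isStarProjection_lineProj hcs
  have key := h.isStarProjection hΦ hf hΦ0 hf0 (posDef_twoPoint hE ha hb) hP
  rw [matFun_twoPoint hE, kuboMean_lineProj (extendConst_zero _ _) hcs ha hb,
    kuboMean_lineProj (extendConst_zero _ _) hcs (hf.1 a ha) (hf.1 b hb)] at key
  set k := extendConst Φ 0 (c ^ 2 / a + s ^ 2 / b) / (c ^ 2 / a + s ^ 2 / b)
  have hk : k • _root_.lineProj c s = k • _root_.lineProj c s
      + (0 : ℝ) • (1 - _root_.lineProj c s) := by simp
  rw [hk, matFun_twoPoint hP, extendConst_zero, zero_smul, add_zero] at key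
  exact smul_lineProj_injective hcs key

/-- If `f` preserves `σ_Φ` and both functions vanish at `0`, then the adjoint of `f` is affine. -/
lemma PreservesMean.adjFun_convexComb {Φ f : ℝ → ℝ} (h : PreservesMean Φ f) (hΦ : OMone Φ)
    (hnt : ¬ OMTrivial Φ) (hf : OMone f) (hΦ0 : Tendsto Φ (𝓝[>] 0) (𝓝 0))
    (hf0 : Tendsto f (𝓝[>] 0) (𝓝 0)) {p q x y : ℝ} (hp : 0 < p) (hq : 0 < q)
    (hpq : p + q = 1) (hx : 0 < x) (hy : 0 < y) :
    adjFun f (p * x + q * y) = p * adjFun f x + q * adjFun f y := by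
  have hps : √p ^ 2 = p := Real.sq_sqrt hp.le
  have hqs : √q ^ 2 = q := Real.sq_sqrt hq.le
  have hw : 0 < p * x + q * y := by positivity
  have hfx := hf.adjFun.1 x hx
  have hfy := hf.adjFun.1 y hy
  have h1 := h.lineProj hΦ hf hΦ0 hf0 (c := √p) (s := √q) (by rw [hps, hqs, hpq])
    (inv_pos.2 hx) (inv_pos.2 hy)
  have h2 := h.lineProj hΦ hf hΦ0 hf0 (c := 1) (s := 0) (by norm_num)
    (inv_pos.2 hw) (inv_pos.2 hw)
  rw [hps, hqs, div_inv_eq_mul, div_inv_eq_mul] at h1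
  simp only [one_pow, div_inv_eq_mul, one_mul, ne_eq, OfNat.ofNat_ne_zero, not_false_eq_true,
    zero_pow, zero_mul, zero_div, add_zero] at h2
  rw [h1] at h2
  have hL : 0 < p / f x⁻¹ + q / f y⁻¹ := by
    have := hf.1 _ (inv_pos.2 hx)
    have := hf.1 _ (inv_pos.2 hy)
    positivity
  have hR : 0 < 1 / f (p * x + q * y)⁻¹ := one_div_pos.2 (hf.1 _ (inv_pos.2 hw))
  rw [extendConst_of_pos hL, extendConst_of_pos hR] at h2
  have h3 := hΦ.div_injOn hnt hL hR h2
  simp only [adjFun]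
  rw [← one_div, ← h3]
  ring

lemma exists_affine_of_convexComb {g : ℝ → ℝ}
    (h : ∀ p q x y : ℝ, 0 < p → 0 < q → p + q = 1 → 0 < x → 0 < y →
      g (p * x + q * y) = p * g x + q * g y) :
    ∃ α β : ℝ, ∀ t, 0 < t → g t = α + β * t := by
  have key : ∀ x y z, 0 < x → x < y → y < z → (z - y) * g x + (y - x) * g z = (z - x) * g y := by
    intro x y z hx hxy hyz
    have hzx : z - x ≠ 0 := by linarith
    have := h ((z - y) / (z - x)) ((y - x) / (z - x)) x z
      (div_pos (by linarith) (by linarith)) (div_pos (by linarith) (by linarith))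
      (by field_simp; ring) hx (by linarith)
    have e : (z - y) / (z - x) * x + (y - x) / (z - x) * z = y := by field_simp; ring
    rw [e] at this
    rw [this]
    field_simp
  refine ⟨2 * g 1 - g 2, g 2 - g 1, fun t ht => ?_⟩
  rcases lt_trichotomy t 1 with h1 | rfl | h1
  · linear_combination key t 1 2 ht h1 (by norm_num)
  · ring
  rcases lt_trichotomy t 2 with h2 | rfl | h2
  · linear_combination -key 1 t 2 one_pos h1 h2
  · ring
  · linear_combination key 1 2 t one_pos (by norm_num) h2

lemma PreservesMean.eq_id_of_tendsto_atTop {Φ f : ℝ → ℝ} (h : PreservesMean Φ f) (hΦ : OMone Φ)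
    (hnt : ¬ OMTrivial Φ) (hf : OMone f) (hΦ0 : Tendsto Φ (𝓝[>] 0) (𝓝 0))
    (hΦtop : Tendsto Φ atTop atTop) (hf0 : Tendsto f (𝓝[>] 0) (𝓝 0)) {t : ℝ} (ht : 0 < t) :
    f t = t := by
  obtain ⟨α, β, hαβ⟩ := exists_affine_of_convexComb fun p q x y hp hq hpq hx hy =>
    h.adjFun_convexComb hΦ hnt hf hΦ0 hf0 hp hq hpq hx hy
  have h1 : α + β = 1 := by
    have := hαβ 1 one_pos
    rw [hf.adjFun.2.1] at this
    linarith
  have hα : 0 ≤ α := by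
    have := hf.adjFun.div_antitone one_pos one_le_two
    rw [hαβ 1 one_pos, hαβ 2 two_pos] at this
    linarith
  have hβ : 0 ≤ β := by
    have := hf.adjFun.monotoneOn (one_pos (α := ℝ)) (two_pos (α := ℝ)) one_le_two
    rw [hαβ 1 one_pos, hαβ 2 two_pos] at this
    linarith
  have hfeq : ∀ t, 0 < t → f t = (α + β * t⁻¹)⁻¹ := by
    intro t ht
    rw [← hαβ t⁻¹ (inv_pos.2 ht), adjFun, inv_inv, inv_inv]
  have hβ0 : 0 < β := by
    refine hβ.lt_of_ne fun hβ' => ?_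
    obtain rfl : α = 1 := by linarith
    have hc : Tendsto f (𝓝[>] 0) (𝓝 1) :=
      tendsto_const_nhds.congr' (eventually_nhdsWithin_of_forall fun t ht => by
        rw [hfeq t ht, ← hβ']; simp)
    exact zero_ne_one (tendsto_nhds_unique hf0 hc)
  rcases hα.eq_or_lt with rfl | hα0
  · obtain rfl : β = 1 := by linarith
    rw [hfeq t ht]; simp
  exfalso
  have hftop : Tendsto f atTop (𝓝 α⁻¹) := by
    have : Tendsto (fun t : ℝ => (α + β * t⁻¹)⁻¹) atTop (𝓝 (α + β * 0)⁻¹) :=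
      ((tendsto_inv_atTop_zero.const_mul β).const_add α).inv₀ (by simpa using hα0.ne')
    rw [mul_zero, add_zero] at this
    refine this.congr' ?_
    filter_upwards [eventually_gt_atTop 0] with t ht using (hfeq t ht).symm
  have hfix : ∀ a, 0 < a → α⁻¹ = f a * Φ (α⁻¹ / f a) := by
    intro a ha
    have hl : Tendsto (fun b => f (a * Φ (b / a))) atTop (𝓝 α⁻¹) :=
      hftop.comp ((hΦtop.comp (tendsto_id.atTop_div_const ha)).const_mul_atTop ha)
    have hr : Tendsto (fun b => f a * Φ (f b / f a)) atTop (𝓝 (f a * Φ (α⁻¹ / f a))) :=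
      ((hΦ.continuousAt (div_pos (inv_pos.2 hα0) (hf.1 a ha))).tendsto.comp
        (hftop.div_const (f a))).const_mul (f a)
    refine tendsto_nhds_unique_of_eventuallyEq hl hr ?_
    filter_upwards [eventually_gt_atTop 0] with b hb using h.scalar hf.1 ha hb
  refine hnt (hΦ.omTrivial_of_linear (p := 1) (q := 2) (k := 1) one_pos one_lt_two fun y hy => ?_)
  have hy1 : 0 < y - 1 := sub_pos.2 hy.1
  have ha : 0 < β / (α * (y - 1)) := by positivity
  have hfa : f (β / (α * (y - 1))) = (α * y)⁻¹ := by
    rw [hfeq _ ha]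
    congr 1
    field_simp
    ring
  have hy0 : 0 < y := by linarith
  have := hfix _ ha
  have e : α⁻¹ / (α * y)⁻¹ = y := by field_simp
  rw [hfa, e] at this
  field_simp at this
  linarith

lemma tendsto_atTop_of_comp_inv {g : ℝ → ℝ} (h : Tendsto (fun t => g t⁻¹) (𝓝[>] 0) atTop) :
    Tendsto g atTop atTop :=
  (h.comp tendsto_inv_atTop_nhdsGT_zero).congr fun t => by simp

lemma tendsto_atTop_of_adjFun {g : ℝ → ℝ} (hg : ∀ t, 0 < t → 0 < g t)
    (h : Tendsto (adjFun g) (𝓝[>] 0) (𝓝 0)) : Tendsto g atTop atTop := by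
  have h' : Tendsto (adjFun g) (𝓝[>] 0) (𝓝[>] 0) :=
    tendsto_nhdsWithin_of_tendsto_nhds_of_eventually_within _ h
      (eventually_nhdsWithin_of_forall fun t ht => inv_pos.2 (hg _ (inv_pos.2 ht)))
  refine tendsto_atTop_of_comp_inv ((tendsto_inv_nhdsGT_zero.comp h').congr fun t => ?_)
  simp [adjFun]

lemma tendsto_atTop_of_transFun {g : ℝ → ℝ} {b : ℝ} (hb : 0 < b)
    (h : Tendsto (transFun g) (𝓝[>] 0) (𝓝 b)) : Tendsto g atTop atTop := by
  refine tendsto_atTop_of_comp_inv ((h.pos_mul_atTop hb tendsto_inv_nhdsGT_zero).congr'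
    (eventually_nhdsWithin_of_forall fun t ht => ?_))
  rw [transFun, mul_right_comm, mul_inv_cancel₀ (ne_of_gt ht), one_mul]

theorem stmt_11 (f Φ : ℝ → ℝ) (hΦ : OMone Φ) (hΦnt : ¬ OMTrivial Φ)
    (hΦhyp : Filter.Tendsto (adjFun Φ) (nhdsWithin 0 (Set.Ioi 0)) (nhds 0) ∨
      ∃ a b : ℝ, Filter.Tendsto Φ (nhdsWithin 0 (Set.Ioi 0)) (nhds a) ∧
        Filter.Tendsto (transFun Φ) (nhdsWithin 0 (Set.Ioi 0)) (nhds b) ∧ 0 < a + b)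
    (hf : OMone f) (hf0 : Filter.Tendsto f (nhdsWithin 0 (Set.Ioi 0)) (nhds 0))
    (hpres : PreservesMean Φ f) :
    OMTrivial f ∧ ∀ t : ℝ, 0 < t → f t = t := by
  obtain ⟨L, hL0, hΦL, hLle⟩ := hΦ.exists_tendsto_zero
  have key : ∀ t : ℝ, 0 < t → f t = t := by
    intro t ht
    rcases hL0.eq_or_lt with rfl | hL
    · refine hpres.eq_id_of_tendsto_atTop hΦ hΦnt hf hΦL ?_ hf0 ht
      rcases hΦhyp with hadj | ⟨a, b, ha, hb, hab⟩
      · exact tendsto_atTop_of_adjFun hΦ.1 hadj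
      · obtain rfl := tendsto_nhds_unique ha hΦL
        exact tendsto_atTop_of_transFun (by simpa using hab) hb
    · exact hf.eq_id_of_map_mul hL (hΦ.tendsto_zero_lt_one hΦnt hLle)
        (fun a ha => hpres.mul_limit_zero hf hf0 hL hΦL ha) ht
  exact ⟨Or.inr key, key⟩
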